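/- For every constant ε > 0 there exists a constant c > 1 such that for every sufficiently large n there exists a function 2nmExt : {0,1}^n × {0,1}^n → {0,1} with the following property: for any two independent sources X and Y on {0,1}^n each of min-entropy at least c·log n, and any functions f, g : {0,1}^n → {0,1}^n such that at least one of f and g has no fixed point, it holds that (2nmExt(X,Y), 2nmExt(f(X), g(Y))) ≈_ε (U₁, 2nmExt(f(X), g(Y))). -/

import Mathlib

open scoped Classical

/-- Statistical distance between two PMFs on a finite type. -/
noncomputable def statDist {α : Type*} [Fintype α] (p q : PMF α) : ℝ :=
  (1/2) * ∑ a, |(p a).toReal - (q a).toReal|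

/-- `X` has min-entropy at least `k` (in bits). -/
def MinEntropyGe {α : Type*} (p : PMF α) (k : ℝ) : Prop :=
  ∀ a, (p a).toReal ≤ (2 : ℝ) ^ (-k)

/-- Product of two independent PMFs. -/
noncomputable def prodPMF {α β : Type*} (p : PMF α) (q : PMF β) : PMF (α × β) :=
  p.bind fun a => q.map fun b => (a, b)

/-- The sign `±1` attached to a bit. -/
def boolSign (b : Bool) : ℝ := if b then 1 else -1

lemma abs_boolSign (b : Bool) : |boolSign b| = 1 := by
  cases b <;> simp [boolSign]

lemma boolSign_beq (b c : Bool) : boolSign (b == c) = boolSign b * boolSign c := by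
  cases b <;> cases c <;> simp [boolSign]

section ExponentialMoment

variable {ι V : Type*}

/-- Multiply the signs of `e` at the points `P i` by its signs at the points `Q i`. -/
noncomputable def twist (P Q : ι → V) (e : V → Bool) (v : V) : Bool :=
  if h : ∃ i, P i = v then e v == e (Q h.choose) else e v

lemma twist_apply {P Q : ι → V} (hP : Function.Injective P) (e : V → Bool) (i : ι) :
    twist P Q e (P i) = (e (P i) == e (Q i)) := by
  have h : ∃ j, P j = P i := ⟨i, rfl⟩
  have hc : h.choose = i := hP h.choose_spec
  rw [twist, dif_pos h, hc]

lemma twist_apply_of_ne {P Q : ι → V} (e : V → Bool) {v : V} (hv : ∀ i, v ≠ P i) :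
    twist P Q e v = e v := by
  rw [twist, dif_neg]
  rintro ⟨i, rfl⟩
  exact hv i rfl

lemma twist_involutive {P Q : ι → V} (hP : Function.Injective P) (hPQ : ∀ i j, Q i ≠ P j) :
    Function.Involutive (twist P Q) := by
  intro e
  funext v
  by_cases h : ∃ i, P i = v
  · obtain ⟨i, rfl⟩ := h
    rw [twist_apply hP, twist_apply hP, twist_apply_of_ne e (hPQ i)]
    cases e (P i) <;> cases e (Q i) <;> rfl
  · have hv : ∀ i, v ≠ P i := fun i hi => h ⟨i, hi.symm⟩
    rw [twist_apply_of_ne _ hv, twist_apply_of_ne _ hv]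

variable [Fintype ι] [Fintype V] [DecidableEq V]

lemma sum_exp_boolSign_le {P : ι → V} (hP : Function.Injective P) (l : ℝ) :
    ∑ e : V → Bool, Real.exp (l * ∑ i, boolSign (e (P i))) ≤
      2 ^ Fintype.card V * Real.exp (l ^ 2 / 2 * Fintype.card ι) := by
  have h1 : ∀ e : V → Bool, Real.exp (l * ∑ i, boolSign (e (P i))) =
      ∏ v, if v ∈ Finset.univ.image P then Real.exp (l * boolSign (e v)) else 1 := by
    intro e
    rw [Finset.prod_ite_mem, Finset.univ_inter, Finset.prod_image (fun i _ j _ h => hP h),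
      Finset.mul_sum, Real.exp_sum]
  have h2 : ∑ e : V → Bool, Real.exp (l * ∑ i, boolSign (e (P i))) =
      ∏ v : V, ∑ b : Bool,
        if v ∈ Finset.univ.image P then Real.exp (l * boolSign b) else 1 := by
    rw [Finset.prod_univ_sum, Fintype.piFinset_univ]
    exact Finset.sum_congr rfl fun e _ => h1 e
  have h3 : ∀ v : V, (∑ b : Bool,
        if v ∈ Finset.univ.image P then Real.exp (l * boolSign b) else 1) ≤
      2 * if v ∈ Finset.univ.image P then Real.exp (l ^ 2 / 2) else 1 := by
    intro v
    split_ifs with h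
    · have := Real.cosh_le_exp_half_sq l
      rw [Real.cosh_eq] at this
      simp [boolSign]
      linarith
    · simp
  rw [h2]
  calc _ ≤ ∏ v : V, (2 * if v ∈ Finset.univ.image P then Real.exp (l ^ 2 / 2) else 1) := by
        refine Finset.prod_le_prod (fun v _ => Finset.sum_nonneg fun b _ => ?_) fun v _ => h3 v
        split_ifs <;> positivity
    _ = _ := by
        rw [Finset.prod_mul_distrib, Finset.prod_ite_mem, Finset.univ_inter, Finset.prod_const,
          Finset.prod_const, Finset.card_image_of_injective _ hP, ← Real.exp_nat_mul]
        simp [Finset.card_univ, mul_comm]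

lemma sum_exp_correlation_le {P Q : ι → V} (hP : Function.Injective P)
    (hPQ : ∀ i j, Q i ≠ P j) (l : ℝ) :
    ∑ e : V → Bool, Real.exp (l * ∑ i, boolSign (e (P i)) * boolSign (e (Q i))) ≤
      2 ^ Fintype.card V * Real.exp (l ^ 2 / 2 * Fintype.card ι) := by
  refine le_trans (le_of_eq ?_) (sum_exp_boolSign_le hP l)
  refine Fintype.sum_equiv (twist_involutive hP hPQ).toPerm _ _ fun e => ?_
  simp [twist_apply hP, boolSign_beq]

lemma sum_exp_abs_correlation_le {P Q : ι → V} (hP : Function.Injective P)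
    (hPQ : ∀ i j, Q i ≠ P j) (l : ℝ) :
    ∑ e : V → Bool, Real.exp (l * |∑ i, boolSign (e (P i)) * boolSign (e (Q i))|) ≤
      2 * (2 ^ Fintype.card V * Real.exp (l ^ 2 / 2 * Fintype.card ι)) := by
  have h1 := sum_exp_correlation_le hP hPQ l
  have h2 := sum_exp_correlation_le hP hPQ (-l)
  rw [neg_sq] at h2
  rw [two_mul]
  refine le_trans ?_ (add_le_add h1 h2)
  rw [← Finset.sum_add_distrib]
  refine Finset.sum_le_sum fun e _ => ?_
  rcases abs_choice (∑ i, boolSign (e (P i)) * boolSign (e (Q i))) with h | h <;> rw [h]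
  · exact le_add_of_nonneg_right (Real.exp_nonneg _)
  · rw [mul_neg, ← neg_mul]
    exact le_add_of_nonneg_left (Real.exp_nonneg _)

end ExponentialMoment

/-- A random two-argument function has small correlation with any shifted copy of itself, on
every rectangle of side `m` which is disjoint from its shift. -/
lemma exists_small_correlation (β : Type*) [Fintype β] {m : ℕ} {δ : ℝ} (hδ : 0 < δ)
    (hcard : 2 * (Fintype.card β : ℝ) ^ (4 * m) ≤ Real.exp (δ ^ 2 / 2 * (m * m))) :
    ∃ e : β × β → Bool, ∀ a b a' b' : Fin m → β, Function.Injective a → Function.Injective b →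
      (∀ s t s' t', (a' s, b' t) ≠ (a s', b t')) →
      |∑ i : Fin m × Fin m,
        boolSign (e (a i.1, b i.2)) * boolSign (e (a' i.1, b' i.2))| ≤ δ * (m * m) := by
  by_contra! hbad
  let ind := (Fin m → β) × (Fin m → β) × (Fin m → β) × (Fin m → β)
  let corr (e : β × β → Bool) (w : ind) : ℝ := ∑ i : Fin m × Fin m,
    boolSign (e (w.1 i.1, w.2.1 i.2)) * boolSign (e (w.2.2.1 i.1, w.2.2.2 i.2))
  let good : Finset ind := {w | Function.Injective w.1 ∧ Function.Injective w.2.1 ∧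
    ∀ s t s' t', (w.2.2.1 s, w.2.2.2 t) ≠ (w.1 s', w.2.1 t')}
  have hup : ∑ e : β × β → Bool, ∑ w ∈ good, Real.exp (δ * |corr e w|) ≤
      Fintype.card ind * (2 * (2 ^ Fintype.card (β × β) * Real.exp (δ ^ 2 / 2 * (m * m)))) := by
    rw [Finset.sum_comm]
    calc _ ≤ ∑ w ∈ good, 2 * (2 ^ Fintype.card (β × β) * Real.exp (δ ^ 2 / 2 * (m * m))) := by
          refine Finset.sum_le_sum fun w hw => ?_
          obtain ⟨ha, hb, hab⟩ := (Finset.mem_filter.1 hw).2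
          have := sum_exp_abs_correlation_le (ι := Fin m × Fin m)
            (P := fun i => (w.1 i.1, w.2.1 i.2)) (Q := fun i => (w.2.2.1 i.1, w.2.2.2 i.2))
            (ha.prodMap hb) (fun i j => hab _ _ _ _) δ
          simpa using this
      _ ≤ _ := by
          rw [Finset.sum_const, nsmul_eq_mul]
          gcongr
          exact Finset.card_le_univ _
  have hlow : ∑ e : β × β → Bool, Real.exp (δ * (δ * (m * m))) <
      ∑ e : β × β → Bool, ∑ w ∈ good, Real.exp (δ * |corr e w|) := by
    refine Finset.sum_lt_sum_of_nonempty Finset.univ_nonempty fun e _ => ?_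
    obtain ⟨a, b, a', b', ha, hb, hab, hlt⟩ := hbad e
    have hmem : ((a, b, a', b') : ind) ∈ good :=
      Finset.mem_filter.2 ⟨Finset.mem_univ _, ha, hb, hab⟩
    refine lt_of_lt_of_le (Real.exp_lt_exp.2 ?_)
      (Finset.single_le_sum (f := fun w => Real.exp (δ * |corr e w|))
        (fun w _ => Real.exp_nonneg _) hmem)
    exact mul_lt_mul_of_pos_left hlt hδ
  have hind : (Fintype.card ind : ℝ) = (Fintype.card β : ℝ) ^ (4 * m) := by
    simp only [ind, Fintype.card_prod, Fintype.card_fun, Fintype.card_fin, Nat.cast_mul,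
      Nat.cast_pow]
    ring
  have hlt := hlow.trans_le hup
  rw [hind, Finset.sum_const, nsmul_eq_mul, Finset.card_univ, Fintype.card_fun,
    Fintype.card_bool, Nat.cast_pow, Nat.cast_two] at hlt
  have hE : Real.exp (δ * (δ * (m * m))) =
      Real.exp (δ ^ 2 / 2 * (m * m)) * Real.exp (δ ^ 2 / 2 * (m * m)) := by
    rw [← Real.exp_add]
    ring_nf
  rw [hE] at hlt
  have hpos : 0 < (2 : ℝ) ^ Fintype.card (β × β) * Real.exp (δ ^ 2 / 2 * (m * m)) := by
    positivity
  have := mul_le_mul_of_nonneg_right hcard hpos.le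
  linarith

section Flat

variable {α : Type*} [Fintype α]

/-- If a weighted sum with small weights is large then so is the average over some set of
prescribed size. -/
lemma exists_injective_sum_gt {p r : α → ℝ} {C : Finset α} {K δ : ℝ} {m : ℕ} (hK : 0 < K)
    (hm : 0 < m) (hδ : 0 < δ) (hp0 : ∀ x, 0 ≤ p x) (hpK : ∀ x, p x ≤ K⁻¹)
    (hp1 : ∑ x, p x = 1) (hr : ∀ x, r x ≤ 1) (hmK : m ≤ δ * K)
    (h : 2 * δ < ∑ x ∈ C, p x * r x) :
    ∃ a : Fin m → α, Function.Injective a ∧ (∀ s, a s ∈ C) ∧ δ * m < ∑ s, r (a s) := by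
  set T := C.filter fun x => δ < r x
  have h1 : ∑ x ∈ C, p x * r x ≤ ∑ x ∈ C, ((if δ < r x then p x else 0) + δ * p x) := by
    refine Finset.sum_le_sum fun x _ => ?_
    split_ifs with hx
    · nlinarith [hp0 x, hr x, mul_nonneg hδ.le (hp0 x)]
    · nlinarith [hp0 x, not_lt.1 hx]
  have h2 : ∑ x ∈ C, δ * p x ≤ δ := by
    rw [← Finset.mul_sum]
    have : ∑ x ∈ C, p x ≤ 1 := hp1 ▸
      Finset.sum_le_sum_of_subset_of_nonneg (Finset.subset_univ _) fun x _ _ => hp0 x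
    nlinarith
  have h3 : ∑ x ∈ C, (if δ < r x then p x else 0) ≤ T.card * K⁻¹ := by
    rw [← Finset.sum_filter, ← nsmul_eq_mul]
    exact Finset.sum_le_card_nsmul _ _ _ fun x _ => hpK x
  rw [Finset.sum_add_distrib] at h1
  have h4 : δ < T.card * K⁻¹ := by linarith
  have h5 : δ * K < T.card := by rwa [← div_eq_mul_inv, lt_div_iff₀ hK] at h4
  have h6 : m ≤ T.card := by exact_mod_cast hmK.trans h5.le
  obtain ⟨S, hST, hS⟩ := Finset.exists_subset_card_eq h6
  let a : Fin m → α := fun s => S.equivFinOfCardEq hS |>.symm s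
  have haS : ∀ s, a s ∈ T := fun s => hST (Subtype.prop _)
  refine ⟨a, Subtype.val_injective.comp (Equiv.injective _),
    fun s => (Finset.mem_filter.1 (haS s)).1, ?_⟩
  have : Nonempty (Fin m) := ⟨⟨0, hm⟩⟩
  calc δ * m = ∑ _s : Fin m, δ := by simp [mul_comm]
    _ < _ := Finset.sum_lt_sum_of_nonempty Finset.univ_nonempty
        fun s _ => (Finset.mem_filter.1 (haS s)).2

lemma bilinear_le_of_flat {p q : α → ℝ} {h : α → α → ℝ} {C D : Finset α} {K δ : ℝ} {m : ℕ}
    (hK : 0 < K) (hm : 0 < m) (hδ : 0 < δ) (hp0 : ∀ x, 0 ≤ p x) (hpK : ∀ x, p x ≤ K⁻¹)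
    (hp1 : ∑ x, p x = 1) (hq0 : ∀ x, 0 ≤ q x) (hqK : ∀ x, q x ≤ K⁻¹)
    (hq1 : ∑ x, q x = 1) (hh : ∀ x y, h x y ≤ 1) (hmK : m ≤ δ * K)
    (hflat : ∀ a b : Fin m → α, Function.Injective a → Function.Injective b →
      (∀ s, a s ∈ C) → (∀ t, b t ∈ D) → ∑ s, ∑ t, h (a s) (b t) ≤ δ * (m * m)) :
    ∑ x ∈ C, p x * ∑ y ∈ D, q y * h x y ≤ 4 * δ := by
  by_contra! hlt
  have hm' : (0 : ℝ) < m := by exact_mod_cast hm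
  obtain ⟨a, ha, haC, hsum⟩ := exists_injective_sum_gt (r := fun x => ∑ y ∈ D, q y * h x y)
    (δ := 2 * δ) hK hm (by linarith) hp0 hpK hp1
    (fun x => by
      calc ∑ y ∈ D, q y * h x y ≤ ∑ y ∈ D, q y :=
            Finset.sum_le_sum fun y _ => mul_le_of_le_one_right (hq0 y) (hh x y)
        _ ≤ ∑ y, q y :=
            Finset.sum_le_sum_of_subset_of_nonneg (Finset.subset_univ _) fun y _ _ => hq0 y
        _ = 1 := hq1)
    (by nlinarith [mul_pos hδ hK]) (by linarith)
  have hswap : ∑ s, ∑ y ∈ D, q y * h (a s) y =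
      m * ∑ y ∈ D, q y * ((∑ s, h (a s) y) / m) := by
    rw [Finset.sum_comm, Finset.mul_sum]
    refine Finset.sum_congr rfl fun y _ => ?_
    rw [← Finset.mul_sum]
    field_simp
  rw [hswap, mul_comm (2 * δ)] at hsum
  obtain ⟨b, hb, hbD, hsum'⟩ := exists_injective_sum_gt (r := fun y => (∑ s, h (a s) y) / m)
    (δ := δ) hK hm hδ hq0 hqK hq1
    (fun y => by
      rw [div_le_one hm']
      calc ∑ s, h (a s) y ≤ ∑ _s : Fin m, (1 : ℝ) := Finset.sum_le_sum fun s _ => hh _ _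
        _ = m := by simp)
    hmK (lt_of_mul_lt_mul_left hsum hm'.le)
  rw [← Finset.sum_div, lt_div_iff₀ hm', Finset.sum_comm] at hsum'
  have := hflat a b ha hb haC hbD
  linarith

lemma abs_bilinear_le_of_flat {p q : α → ℝ} {h : α → α → ℝ} {C D : Finset α} {K δ : ℝ} {m : ℕ}
    (hK : 0 < K) (hm : 0 < m) (hδ : 0 < δ) (hp0 : ∀ x, 0 ≤ p x) (hpK : ∀ x, p x ≤ K⁻¹)
    (hp1 : ∑ x, p x = 1) (hq0 : ∀ x, 0 ≤ q x) (hqK : ∀ x, q x ≤ K⁻¹)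
    (hq1 : ∑ x, q x = 1) (hh : ∀ x y, |h x y| ≤ 1) (hmK : m ≤ δ * K)
    (hflat : ∀ a b : Fin m → α, Function.Injective a → Function.Injective b →
      (∀ s, a s ∈ C) → (∀ t, b t ∈ D) → |∑ s, ∑ t, h (a s) (b t)| ≤ δ * (m * m)) :
    |∑ x ∈ C, p x * ∑ y ∈ D, q y * h x y| ≤ 4 * δ := by
  rw [abs_le']
  refine ⟨bilinear_le_of_flat hK hm hδ hp0 hpK hp1 hq0 hqK hq1
    (fun x y => (abs_le.1 (hh x y)).2) hmK
    fun a b ha hb hC hD => (abs_le.1 (hflat a b ha hb hC hD)).2, ?_⟩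
  have := bilinear_le_of_flat (h := fun x y => -h x y) (C := C) (D := D) hK hm hδ hp0 hpK hp1
    hq0 hqK hq1 (fun x y => by linarith [(abs_le.1 (hh x y)).1]) hmK
    fun a b ha hb hC hD => by
      simp only [Finset.sum_neg_distrib]
      linarith [(abs_le.1 (hflat a b ha hb hC hD)).1]
  simpa only [mul_neg, Finset.sum_neg_distrib] using this

end Flat

/-- A map without fixed points on bit strings has a colouring by a coordinate and a bit for
which no point has the same colour class as its image. -/
lemma exists_coordinate_colouring {n : ℕ} (hn : 0 < n)
    (f : (Fin n → Bool) → Option (Fin n → Bool)) (hf : ∀ x, f x ≠ some x) :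
    ∃ κ : (Fin n → Bool) → Fin n × Bool,
      ∀ x x' : Fin n → Bool, κ x = κ x' → f x ≠ some x' := by
  have key : ∀ x, ∃ i, ∀ z, f x = some z → z i ≠ x i := by
    intro x
    cases hx : f x with
    | none => exact ⟨⟨0, hn⟩, by simp⟩
    | some z =>
      have hz : z ≠ x := fun h => hf x (h ▸ hx)
      obtain ⟨i, hi⟩ := Function.ne_iff.1 hz
      exact ⟨i, fun z' hz' => by cases hz'; exact hi⟩
  choose i hi using key
  refine ⟨fun x => (i x, x (i x)), fun x x' h hfx => ?_⟩
  obtain ⟨h1, h2⟩ := Prod.ext_iff.1 h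
  have h3 : x (i x) = x' (i x') := h2
  have h4 : i x = i x' := h1
  exact hi x x' hfx (by rw [h3, h4])

lemma abs_expect_correlation_le {n m : ℕ} (hn : 0 < n) (hm : 0 < m) {K δ : ℝ} (hK : 0 < K)
    (hδ : 0 < δ) (hmK : m ≤ δ * K) {e : Option (Fin n → Bool) × Option (Fin n → Bool) → Bool}
    (he : ∀ a b a' b' : Fin m → Option (Fin n → Bool),
      Function.Injective a → Function.Injective b →
      (∀ s t s' t', (a' s, b' t) ≠ (a s', b t')) →
      |∑ i : Fin m × Fin m,
        boolSign (e (a i.1, b i.2)) * boolSign (e (a' i.1, b' i.2))| ≤ δ * (m * m))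
    {p q : (Fin n → Bool) → ℝ} (hp0 : ∀ x, 0 ≤ p x) (hpK : ∀ x, p x ≤ K⁻¹)
    (hp1 : ∑ x, p x = 1) (hq0 : ∀ x, 0 ≤ q x) (hqK : ∀ x, q x ≤ K⁻¹) (hq1 : ∑ x, q x = 1)
    (f g : (Fin n → Bool) → Option (Fin n → Bool))
    (hfg : (∀ x, f x ≠ some x) ∨ (∀ y, g y ≠ some y)) :
    |∑ x, p x * ∑ y, q y * (boolSign (e (some x, some y)) * boolSign (e (f x, g y)))| ≤
      8 * n * δ := by
  set h : (Fin n → Bool) → (Fin n → Bool) → ℝ :=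
    fun x y => boolSign (e (some x, some y)) * boolSign (e (f x, g y)) with hh
  have hh1 : ∀ x y, |h x y| ≤ 1 := fun x y => by simp [hh, abs_mul, abs_boolSign]
  have block : ∀ C D : Finset (Fin n → Bool),
      (∀ x ∈ C, ∀ y ∈ D, ∀ x' ∈ C, ∀ y' ∈ D, (f x, g y) ≠ (some x', some y')) →
      |∑ x ∈ C, p x * ∑ y ∈ D, q y * h x y| ≤ 4 * δ := by
    intro C D hCD
    refine abs_bilinear_le_of_flat hK hm hδ hp0 hpK hp1 hq0 hqK hq1 hh1 hmK ?_
    intro a b ha hb haC hbD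
    have := he (fun s => some (a s)) (fun t => some (b t)) (fun s => f (a s)) (fun t => g (b t))
      ((Option.some_injective _).comp ha) ((Option.some_injective _).comp hb)
      fun s t s' t' => hCD _ (haC s) _ (hbD t) _ (haC s') _ (hbD t')
    rwa [Fintype.sum_prod_type] at this
  have hcard : ∑ _k : Fin n × Bool, 4 * δ = 8 * n * δ := by
    simp
    ring
  rw [← hcard]
  rcases hfg with hf | hg
  · obtain ⟨κ, hκ⟩ := exists_coordinate_colouring hn f hf
    rw [← Finset.sum_fiberwise Finset.univ κ]
    refine (Finset.abs_sum_le_sum_abs _ _).trans (Finset.sum_le_sum fun k _ => ?_)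
    refine block _ _ fun x hx y _ x' hx' y' _ heq => ?_
    exact hκ x x' ((Finset.mem_filter.1 hx).2.trans (Finset.mem_filter.1 hx').2.symm)
      (Prod.ext_iff.1 heq).1
  · obtain ⟨κ, hκ⟩ := exists_coordinate_colouring hn g hg
    have hsplit : ∑ x, p x * ∑ y, q y * h x y =
        ∑ k, ∑ x, p x * ∑ y with κ y = k, q y * h x y := by
      rw [Finset.sum_comm]
      refine Finset.sum_congr rfl fun x _ => ?_
      rw [← Finset.mul_sum, Finset.sum_fiberwise]
    rw [hsplit]
    refine (Finset.abs_sum_le_sum_abs _ _).trans (Finset.sum_le_sum fun k _ => ?_)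
    refine block _ _ fun x _ y hy x' _ y' hy' heq => ?_
    exact hκ y y' ((Finset.mem_filter.1 hy).2.trans (Finset.mem_filter.1 hy').2.symm)
      (Prod.ext_iff.1 heq).2

section PMF

variable {α β γ : Type*}

lemma prodPMF_apply (p : PMF α) (q : PMF β) (a : α) (b : β) :
    prodPMF p q (a, b) = p a * q b := by
  rw [prodPMF, PMF.bind_apply, tsum_eq_single a]
  · rw [PMF.map_apply, tsum_eq_single b]
    · simp
    · intro b' hb'
      simp [hb'.symm]
  · intro a' ha'
    simp [PMF.map_apply, ha'.symm]

lemma sum_toReal_eq_one [Fintype α] (p : PMF α) : ∑ a, (p a).toReal = 1 := by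
  have h := p.tsum_coe
  rw [tsum_fintype] at h
  rw [← ENNReal.toReal_sum fun a _ => p.apply_ne_top a, h, ENNReal.toReal_one]

lemma map_prodPMF_toReal [Fintype α] [Fintype β] (p : PMF α) (q : PMF β) (F : α × β → γ)
    (c : γ) : (((prodPMF p q).map F) c).toReal =
      ∑ a, (p a).toReal * ∑ b, (q b).toReal * if c = F (a, b) then 1 else 0 := by
  rw [PMF.map_apply, tsum_fintype, ENNReal.toReal_sum]
  · rw [Fintype.sum_prod_type]
    refine Finset.sum_congr rfl fun a _ => ?_
    rw [Finset.mul_sum]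
    refine Finset.sum_congr rfl fun b _ => ?_
    split_ifs <;> simp [prodPMF_apply]
  · intro x _
    split_ifs
    · exact PMF.apply_ne_top _ _
    · simp

/-- The XOR lemma for a single bit with one bit of side information. -/
lemma statDist_uniform_le [Fintype α] [Fintype β] (p : PMF α) (q : PMF β)
    (A B : α × β → Bool) {ε : ℝ}
    (hA : |∑ x, (p x).toReal * ∑ y, (q y).toReal * boolSign (A (x, y))| ≤ ε)
    (hAB : |∑ x, (p x).toReal * ∑ y, (q y).toReal *
      (boolSign (A (x, y)) * boolSign (B (x, y)))| ≤ ε) :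
    statDist ((prodPMF p q).map fun z => (A z, B z))
      (prodPMF (PMF.uniformOfFintype Bool) ((prodPMF p q).map fun z => B z)) ≤ ε := by
  set P : Bool → Bool → ℝ := fun a b => (((prodPMF p q).map fun z => (A z, B z)) (a, b)).toReal
    with hP
  have hB : ∀ b, (((prodPMF p q).map fun z => B z) b).toReal = P true b + P false b := by
    intro b
    simp only [hP, map_prodPMF_toReal, ← Finset.sum_add_distrib, ← mul_add]
    refine Finset.sum_congr rfl fun x _ => ?_
    congr 1
    refine Finset.sum_congr rfl fun y _ => ?_
    congr 1
    cases A (x, y) <;> simp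
  have hA' : ∑ x, (p x).toReal * ∑ y, (q y).toReal * boolSign (A (x, y)) =
      P true true + P true false - P false true - P false false := by
    simp only [hP, map_prodPMF_toReal, ← Finset.sum_add_distrib, ← mul_add,
      ← Finset.sum_sub_distrib, ← mul_sub]
    refine Finset.sum_congr rfl fun x _ => ?_
    congr 1
    refine Finset.sum_congr rfl fun y _ => ?_
    congr 1
    cases A (x, y) <;> cases B (x, y) <;> simp [boolSign]
  have hAB' : ∑ x, (p x).toReal * ∑ y, (q y).toReal *
      (boolSign (A (x, y)) * boolSign (B (x, y))) =
      P true true - P true false - P false true + P false false := by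
    simp only [hP, map_prodPMF_toReal, ← Finset.sum_add_distrib, ← mul_add,
      ← Finset.sum_sub_distrib, ← mul_sub]
    refine Finset.sum_congr rfl fun x _ => ?_
    congr 1
    refine Finset.sum_congr rfl fun y _ => ?_
    congr 1
    cases A (x, y) <;> cases B (x, y) <;> simp [boolSign]
  rw [hA'] at hA
  rw [hAB'] at hAB
  have hU : ∀ a b, (prodPMF (PMF.uniformOfFintype Bool)
      ((prodPMF p q).map fun z => B z) (a, b)).toReal = (P true b + P false b) / 2 := by
    intro a b
    rw [prodPMF_apply, ENNReal.toReal_mul, hB]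
    simp
    ring
  have hD : ∀ b, |P true b - (P true b + P false b) / 2| = |P true b - P false b| / 2 ∧
      |P false b - (P true b + P false b) / 2| = |P true b - P false b| / 2 := by
    intro b
    constructor
    · rw [← abs_two, ← abs_div, abs_two]
      congr 1
      ring
    · rw [← abs_two, ← abs_div, abs_two, ← abs_neg]
      congr 1
      ring
  have hsum : statDist ((prodPMF p q).map fun z => (A z, B z))
      (prodPMF (PMF.uniformOfFintype Bool) ((prodPMF p q).map fun z => B z)) =
      (|P true true - P false true| + |P true false - P false false|) / 2 := by
    rw [statDist, Fintype.sum_prod_type]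
    simp only [hU, Fintype.sum_bool]
    change 1 / 2 * (|P true true - _| + |P true false - _| +
      (|P false true - _| + |P false false - _|)) = _
    rw [(hD true).1, (hD true).2, (hD false).1, (hD false).2]
    ring
  rw [hsum]
  rw [abs_le] at hA hAB
  cases abs_cases (P true true - P false true) <;>
    cases abs_cases (P true false - P false false) <;> linarith

end PMF

lemma two_mul_card_pow_le_exp {n : ℕ} (hn : 0 < n) {ε : ℝ} (hε : 0 < ε)
    (hnε : 1152 / ε ^ 2 ≤ n) :
    2 * (Fintype.card (Option (Fin n → Bool)) : ℝ) ^ (4 * n ^ 4) ≤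
      Real.exp ((ε / (8 * n)) ^ 2 / 2 * ((n ^ 4 : ℕ) * (n ^ 4 : ℕ))) := by
  have hn1 : (1 : ℝ) ≤ n := by exact_mod_cast hn
  have hcard : (Fintype.card (Option (Fin n → Bool)) : ℝ) ≤ 2 ^ (n + 1) := by
    simp only [Fintype.card_option, Fintype.card_fun, Fintype.card_bool, Fintype.card_fin]
    push_cast
    rw [pow_succ]
    linarith [one_le_pow₀ (M₀ := ℝ) (n := n) one_le_two]
  have h2 : (2 : ℝ) ≤ Real.exp 1 := by linarith [Real.add_one_le_exp 1]
  calc 2 * (Fintype.card (Option (Fin n → Bool)) : ℝ) ^ (4 * n ^ 4)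
      ≤ 2 * (2 ^ (n + 1)) ^ (4 * n ^ 4) := by gcongr
    _ = 2 ^ (1 + (n + 1) * (4 * n ^ 4)) := by rw [← pow_mul, pow_add, pow_one]
    _ ≤ Real.exp 1 ^ (1 + (n + 1) * (4 * n ^ 4)) := by gcongr
    _ = Real.exp ((1 + (n + 1) * (4 * n ^ 4) : ℕ)) := by rw [← Real.exp_nat_mul, mul_one]
    _ ≤ _ := by
      refine Real.exp_le_exp.2 ?_
      have hdiv : 1152 ≤ n * ε ^ 2 := by rwa [div_le_iff₀ (by positivity)] at hnε
      have hrhs : (ε / (8 * n)) ^ 2 / 2 * (((n ^ 4 : ℕ) : ℝ) * (n ^ 4 : ℕ)) =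
          (n * ε ^ 2) * (n : ℝ) ^ 5 / 128 := by
        push_cast
        field_simp
        ring
      rw [hrhs]
      push_cast
      have h4 : (1 : ℝ) ≤ (n : ℝ) ^ 4 := one_le_pow₀ hn1
      have h5 : (n : ℝ) ^ 4 ≤ (n : ℝ) ^ 5 := pow_le_pow_right₀ hn1 (by norm_num)
      have h6 := mul_le_mul_of_nonneg_right hdiv (by positivity : (0 : ℝ) ≤ (n : ℝ) ^ 5)
      have h7 : ((n : ℝ) + 1) * (4 * (n : ℝ) ^ 4) = 4 * (n : ℝ) ^ 5 + 4 * (n : ℝ) ^ 4 := by ring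
      linarith

/-- Two-source non-malleable extractors for entropy `O(log n)` with constant error
and one output bit. -/
theorem two_source_nm_ext_logarithmic :
    ∀ ε : ℝ, 0 < ε → ∃ c > (1 : ℝ), ∀ᶠ n : ℕ in Filter.atTop,
      ∃ ext : (Fin n → Bool) → (Fin n → Bool) → Bool,
        ∀ X Y : PMF (Fin n → Bool),
          MinEntropyGe X (c * Real.logb 2 n) → MinEntropyGe Y (c * Real.logb 2 n) →
          ∀ f g : (Fin n → Bool) → (Fin n → Bool),
            ((∀ x, f x ≠ x) ∨ (∀ y, g y ≠ y)) →
            statDist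
              ((prodPMF X Y).map fun p => (ext p.1 p.2, ext (f p.1) (g p.2)))
              (prodPMF (PMF.uniformOfFintype Bool)
                ((prodPMF X Y).map fun p => ext (f p.1) (g p.2)))
              ≤ ε := by
  intro ε hε
  refine ⟨6, by norm_num, ?_⟩
  filter_upwards [Filter.eventually_gt_atTop 0,
    tendsto_natCast_atTop_atTop.eventually_ge_atTop (1152 / ε ^ 2),
    tendsto_natCast_atTop_atTop.eventually_ge_atTop (8 / ε)] with n hn hn1 hn2
  have hn0 : (0 : ℝ) < n := by exact_mod_cast hn
  have hδ : 0 < ε / (8 * n) := by positivity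
  have hm : 0 < n ^ 4 := by positivity
  have hK : (0 : ℝ) < (n : ℝ) ^ 6 := by positivity
  have hmK : ((n ^ 4 : ℕ) : ℝ) ≤ ε / (8 * n) * (n : ℝ) ^ 6 := by
    have h8 : 8 ≤ n * ε := by rwa [div_le_iff₀ hε] at hn2
    have : ε / (8 * n) * (n : ℝ) ^ 6 = (n * ε) * (n : ℝ) ^ 4 / 8 := by
      field_simp
    rw [this]
    push_cast
    have := mul_le_mul_of_nonneg_right h8 (by positivity : (0 : ℝ) ≤ (n : ℝ) ^ 4)
    linarith
  obtain ⟨e, he⟩ := exists_small_correlation (Option (Fin n → Bool)) hδ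
    (two_mul_card_pow_le_exp hn hε hn1)
  have hpow : (2 : ℝ) ^ (-(6 * Real.logb 2 n)) = ((n : ℝ) ^ 6)⁻¹ := by
    rw [Real.rpow_neg zero_le_two, mul_comm, Real.rpow_mul zero_le_two,
      Real.rpow_logb two_pos (by norm_num) hn0]
    norm_cast
  refine ⟨fun x y => e (some x, some y), fun X Y hX hY f g hfg => ?_⟩
  have main := abs_expect_correlation_le hn hm hK hδ hmK he
    (p := fun x => (X x).toReal) (q := fun y => (Y y).toReal)
    (fun _ => ENNReal.toReal_nonneg) (fun x => hpow ▸ hX x) (sum_toReal_eq_one X)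
    (fun _ => ENNReal.toReal_nonneg) (fun y => hpow ▸ hY y) (sum_toReal_eq_one Y)
  have hε8 : 8 * n * (ε / (8 * n)) = ε := by field_simp
  rw [hε8] at main
  refine statDist_uniform_le X Y (fun z => e (some z.1, some z.2))
    (fun z => e (some (f z.1), some (g z.2))) ?_ ?_
  · have h := main (fun _ => none) (fun _ => none) (Or.inl fun _ => by simp)
    simp only [← mul_assoc, ← Finset.sum_mul, abs_mul, abs_boolSign, mul_one] at h
    exact h
  · exact main (fun x => some (f x)) (fun y => some (g y)) (by simpa using hfg)
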